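/- arXiv:2407.13728 — 2 statements merged into one kernel-verified Lean document; each statement's English description precedes it below -/
import Mathlib

section
/- For any ensemble (p_1,...,p_r; ρ_1,...,ρ_r) of density operators with p_x > 0 and any α ∈ (1,∞), the one-shot error probability of state exclusion satisfies −ln P_err ≤ lim_{ε→0⁺} −ln Tr[ ( Σ_x (p_x ρ_x + εI)^{1−α} )^{1/(1−α)} ], which equals −ln Tr[ ( Σ_x Π (p_x ρ_x)^{1−α} Π )^{1/(1−α)} ] where Π is the projector onto ∩_x supp(ρ_x). -/
open scoped Kronecker
open Matrix Filter Topology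
open scoped ComplexOrder
attribute [local instance] Classical.propDecidable

namespace QHE

/-- Functional calculus for Hermitian matrices (junk value `0` on non-Hermitian input). -/
noncomputable def mfun {n : Type*} [Fintype n] [DecidableEq n] (f : ℝ → ℝ)
    (A : Matrix n n ℂ) : Matrix n n ℂ :=
  if hA : A.IsHermitian then
    (hA.eigenvectorUnitary : Matrix n n ℂ) *
      Matrix.diagonal (fun i => (f (hA.eigenvalues i) : ℂ)) *
      (star (hA.eigenvectorUnitary : Matrix n n ℂ))
  else 0

/-- Real power of a Hermitian matrix, taken on its support (`0 ^ r = 0`). -/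
noncomputable def mpow {n : Type*} [Fintype n] [DecidableEq n] (A : Matrix n n ℂ) (r : ℝ) :
    Matrix n n ℂ :=
  mfun (fun x => if x = 0 then 0 else Real.rpow x r) A

/-- Logarithm of a Hermitian matrix, taken on its support. -/
noncomputable def mlog {n : Type*} [Fintype n] [DecidableEq n] (A : Matrix n n ℂ) :
    Matrix n n ℂ :=
  mfun (fun x => if x = 0 then 0 else Real.log x) A

/-- `‖X‖_α ^ α = Tr[(Xᴴ X)^(α/2)]`, the α-th power of the Schatten α-norm. -/
noncomputable def schattenPow {n : Type*} [Fintype n] [DecidableEq n] (α : ℝ)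
    (X : Matrix n n ℂ) : ℝ :=
  ((mpow (Xᴴ * X) (α / 2)).trace).re

/-- Support inclusion `supp γ ⊆ supp σ`, phrased as kernel inclusion `ker σ ⊆ ker γ`. -/
noncomputable def suppLE {n : Type*} [Fintype n] (γ σ : Matrix n n ℂ) : Prop :=
  ∀ v : n → ℂ, σ.mulVec v = 0 → γ.mulVec v = 0

/-- Extended sandwiched Rényi quasi-divergence
`Q̃_α(γ∥σ) = ‖σ^((1-α)/(2α)) γ σ^((1-α)/(2α))‖_α^α`. -/
noncomputable def sandQ {n : Type*} [Fintype n] [DecidableEq n] (α : ℝ)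
    (γ σ : Matrix n n ℂ) : ℝ :=
  schattenPow α (mpow σ ((1 - α) / (2 * α)) * γ * mpow σ ((1 - α) / (2 * α)))

/-- Extended sandwiched Rényi divergence (real-valued formula, meaningful when
`supp γ ⊆ supp σ`). -/
noncomputable def sandDR {n : Type*} [Fintype n] [DecidableEq n] (α : ℝ)
    (γ σ : Matrix n n ℂ) : ℝ :=
  (1 / (α - 1)) * Real.log (sandQ α γ σ)

/-- Extended sandwiched Rényi divergence, `+∞` when the support condition fails. -/
noncomputable def sandD {n : Type*} [Fintype n] [DecidableEq n] (α : ℝ)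
    (γ σ : Matrix n n ℂ) : EReal :=
  if suppLE γ σ then ((sandDR α γ σ : ℝ) : EReal) else ⊤

/-- Trace norm `‖X‖₁`. -/
noncomputable def traceNorm {n : Type*} [Fintype n] [DecidableEq n] (X : Matrix n n ℂ) : ℝ :=
  schattenPow 1 X

/-- Absolute value `|X| = (Xᴴ X)^(1/2)`. -/
noncomputable def matAbs {n : Type*} [Fintype n] [DecidableEq n] (X : Matrix n n ℂ) :
    Matrix n n ℂ :=
  mpow (Xᴴ * X) (1 / 2 : ℝ)

/-- Umegaki relative entropy `Tr[ρ(ln ρ − ln σ)]` (real-valued formula). -/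
noncomputable def umegakiR {n : Type*} [Fintype n] [DecidableEq n] (ρ σ : Matrix n n ℂ) : ℝ :=
  ((ρ * (mlog ρ - mlog σ)).trace).re

/-- Umegaki relative entropy, `+∞` when the support condition fails. -/
noncomputable def umegaki {n : Type*} [Fintype n] [DecidableEq n] (ρ σ : Matrix n n ℂ) : EReal :=
  if suppLE ρ σ then ((umegakiR ρ σ : ℝ) : EReal) else ⊤

/-- Density operator: positive semidefinite with unit trace. -/
noncomputable def IsState {n : Type*} [Fintype n] (ρ : Matrix n n ℂ) : Prop :=
  ρ.PosSemidef ∧ ρ.trace = 1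

/-- Unit-trace Hermitian operator. -/
def UnitTraceHerm {n : Type*} [Fintype n] (τ : Matrix n n ℂ) : Prop :=
  τ.IsHermitian ∧ τ.trace = 1

/-- `−ln x`, valued `+∞` for `x ≤ 0`. -/
noncomputable def negLogE (x : ℝ) : EReal :=
  if x ≤ 0 then ⊤ else ((-Real.log x : ℝ) : EReal)

/-- Extended hypothesis-testing divergence
`D_H^ε(τ∥σ) = sup{−ln Tr[Λσ] : 0 ≤ Λ ≤ I, Tr[Λτ] ≥ 1−ε}`. -/
noncomputable def DH {n : Type*} [Fintype n] [DecidableEq n] (ε : ℝ)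
    (τ σ : Matrix n n ℂ) : EReal :=
  ⨆ Λ ∈ {Λ : Matrix n n ℂ |
      Λ.PosSemidef ∧ (1 - Λ).PosSemidef ∧ 1 - ε ≤ ((Λ * τ).trace).re},
    negLogE (((Λ * σ).trace).re)

/-- Optimal error probability of state exclusion for the ensemble `(p, ρ)`. -/
noncomputable def Perr {n ι : Type*} [Fintype n] [DecidableEq n] [Fintype ι]
    (p : ι → ℝ) (ρ : ι → Matrix n n ℂ) : ℝ :=
  sInf {e : ℝ | ∃ Λ : ι → Matrix n n ℂ, (∀ x, (Λ x).PosSemidef) ∧ (∑ x, Λ x = 1) ∧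
    e = ∑ x, p x * (((Λ x) * (ρ x)).trace).re}

/-- Optimal success probability of state discrimination for the ensemble `(p, ρ)`. -/
noncomputable def Psucc {n ι : Type*} [Fintype n] [DecidableEq n] [Fintype ι]
    (p : ι → ℝ) (ρ : ι → Matrix n n ℂ) : ℝ :=
  sSup {e : ℝ | ∃ Λ : ι → Matrix n n ℂ, (∀ x, (Λ x).PosSemidef) ∧ (∑ x, Λ x = 1) ∧
    e = ∑ x, p x * (((Λ x) * (ρ x)).trace).re}

/-- The probability simplex over a finite index type. -/
def probSimplex (ι : Type*) [Fintype ι] : Set (ι → ℝ) :=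
  {s | (∀ x, 0 ≤ s x) ∧ ∑ x, s x = 1}

/-- CPTP maps, characterized by Kraus representations. -/
def IsCPTP {n m : Type*} [Fintype n] [DecidableEq n] [Fintype m] [DecidableEq m]
    (Φ : Matrix n n ℂ → Matrix m m ℂ) : Prop :=
  ∃ (k : ℕ) (K : Fin k → Matrix m n ℂ), (∑ i, (K i)ᴴ * K i = 1) ∧
    ∀ A, Φ A = ∑ i, K i * A * (K i)ᴴ

/-- Completely positive maps, characterized by Kraus representations. -/
def IsCPMap {n m : Type*} [Fintype n] [DecidableEq n] [Fintype m] [DecidableEq m]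
    (Φ : Matrix n n ℂ → Matrix m m ℂ) : Prop :=
  ∃ (k : ℕ) (K : Fin k → Matrix m n ℂ), ∀ A, Φ A = ∑ i, K i * A * (K i)ᴴ

/-- Extension `id_{C^d} ⊗ Φ` of a (linear) map `Φ` to a `d`-dimensional reference system. -/
noncomputable def matExt {n m : Type*} (Φ : Matrix n n ℂ → Matrix m m ℂ) (d : ℕ)
    (X : Matrix (Fin d × n) (Fin d × n) ℂ) : Matrix (Fin d × m) (Fin d × m) ℂ :=
  Matrix.of fun p q => Φ (Matrix.of fun a b => X (p.1, a) (q.1, b)) p.2 q.2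

/-- Partial trace over the first tensor factor. -/
noncomputable def ptraceFst {a b : Type*} [Fintype a] (X : Matrix (a × b) (a × b) ℂ) : Matrix b b ℂ :=
  Matrix.of fun i j => ∑ k : a, X (k, i) (k, j)

/-- `k`-fold tensor power `A^{⊗k}` of a matrix. -/
noncomputable def tensPow {n : Type*} [Fintype n] (A : Matrix n n ℂ) (k : ℕ) :
    Matrix (Fin k → n) (Fin k → n) ℂ :=
  Matrix.of fun f g => ∏ i, A (f i) (g i)

/-- Max-divergence `D_max(ρ∥σ) = inf{ln λ : λ ≥ 0, ρ ≤ λσ}` (`+∞` if infeasible). -/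
noncomputable def Dmax {n : Type*} [Fintype n] [DecidableEq n] (ρ σ : Matrix n n ℂ) : EReal :=
  ⨅ l ∈ {l : ℝ | 0 ≤ l ∧ (l • σ - ρ).PosSemidef}, ((Real.log l : ℝ) : EReal)

/-- Channel divergence induced by a family of state divergences `D`:
supremum over reference dimensions and bipartite input states. -/
noncomputable def Dch
    (D : (k : Type) → [Fintype k] → [DecidableEq k] → Matrix k k ℂ → Matrix k k ℂ → EReal)
    {n m : Type} [Fintype n] [DecidableEq n] [Fintype m] [DecidableEq m]
    (N M : Matrix n n ℂ → Matrix m m ℂ) : EReal :=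
  ⨆ (d : ℕ), ⨆ ρ ∈ {ρ : Matrix (Fin d × n) (Fin d × n) ℂ | IsState ρ},
    D (Fin d × m) (matExt N d ρ) (matExt M d ρ)

section Aux
open scoped MatrixOrder Matrix.Norms.L2Operator

variable {n : Type*} [Fintype n] [DecidableEq n]

lemma mfun_eq_cfc (f : ℝ → ℝ) {A : Matrix n n ℂ} (hA : A.IsHermitian) :
    mfun f A = cfc f A := by
  rw [hA.cfc_eq, mfun, dif_pos hA, Matrix.IsHermitian.cfc, Unitary.conjStarAlgAut_apply]
  rfl

lemma mpow_eq_rpow {A : Matrix n n ℂ} (hA : 0 ≤ A) {r : ℝ} (hr : r ≠ 0) :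
    mpow A r = A ^ r := by
  rw [mpow, mfun_eq_cfc _ hA.posSemidef.1, CFC.rpow_eq_cfc_real hA]
  refine cfc_congr fun x _ => ?_
  split_ifs with h
  · simp [h, Real.zero_rpow hr]
  · rfl

lemma continuousOn_real_spectrum (A : Matrix n n ℂ) (f : ℝ → ℝ) :
    ContinuousOn f (spectrum ℝ A) :=
  (Matrix.finite_real_spectrum (A := A)).continuousOn f

lemma matrix_rpow_rpow {A : Matrix n n ℂ} (hA : 0 ≤ A) (x y : ℝ) :
    (A ^ x) ^ y = A ^ (x * y) := by
  have hfin : ((fun t : ℝ => t ^ x) '' spectrum ℝ A).Finite :=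
    (Matrix.finite_real_spectrum (A := A)).image _
  rw [CFC.rpow_eq_cfc_real (CFC.rpow_nonneg : 0 ≤ A ^ x), CFC.rpow_eq_cfc_real hA,
    CFC.rpow_eq_cfc_real hA,
    ← cfc_comp' (fun t : ℝ => t ^ y) (fun t : ℝ => t ^ x) A (hfin.continuousOn _)
      (continuousOn_real_spectrum A _) (IsSelfAdjoint.of_nonneg hA)]
  refine cfc_congr fun t ht => ?_
  exact (Real.rpow_mul (spectrum_nonneg_of_nonneg hA ht) x y).symm

lemma matrix_rpow_mul_rpow {A : Matrix n n ℂ} (hA : 0 ≤ A) {x y : ℝ}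
    (hxy : x + y ≠ 0) : A ^ x * A ^ y = A ^ (x + y) := by
  rw [CFC.rpow_eq_cfc_real hA, CFC.rpow_eq_cfc_real hA, CFC.rpow_eq_cfc_real hA,
    ← cfc_mul _ _ A (continuousOn_real_spectrum A _) (continuousOn_real_spectrum A _)]
  refine cfc_congr fun t ht => ?_
  exact (Real.rpow_add' (spectrum_nonneg_of_nonneg hA ht) hxy).symm

lemma rpow_neg_one_mul_self_eq {A P : Matrix n n ℂ} (hA : 0 ≤ A) (hP : P.IsHermitian)
    (hPP : P * P = P) (hker : ∀ v : n → ℂ, A *ᵥ v = 0 ↔ P *ᵥ v = 0) :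
    A ^ (-1 : ℝ) * A = P := by
  have key : ∀ B : Matrix n n ℂ, A * B = 0 ↔ P * B = 0 := by
    intro B
    have h (C : Matrix n n ℂ) : C * B = 0 ↔ ∀ j, C *ᵥ (fun i => B i j) = 0 := by
      constructor
      · intro h j
        ext i
        exact congrFun (congrFun h i) j
      · intro h
        ext i j
        exact congrFun (h j) i
    rw [h, h]
    exact forall_congr' fun j => hker _
  set Q := A ^ (-1 : ℝ) * A with hQ
  have hQc : Q = cfc (fun x : ℝ => x ^ (-1 : ℝ) * x) A := by
    rw [cfc_mul _ _ A (continuousOn_real_spectrum A _) (continuousOn_real_spectrum A _),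
      ← CFC.rpow_eq_cfc_real hA, cfc_id' ℝ A (IsSelfAdjoint.of_nonneg hA)]
  have hQh : Qᴴ = Q := by
    rw [hQc]
    exact (cfc_predicate (R := ℝ) (p := IsSelfAdjoint) _ A : IsSelfAdjoint _)
  have hAQ : A * Q = A := by
    nth_rewrite 1 [← cfc_id' ℝ A (IsSelfAdjoint.of_nonneg hA)]
    rw [hQc, ← cfc_mul _ _ A (continuousOn_real_spectrum A _) (continuousOn_real_spectrum A _)]
    conv_rhs => rw [← cfc_id' ℝ A (IsSelfAdjoint.of_nonneg hA)]
    refine cfc_congr fun t _ => ?_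
    rcases eq_or_ne t 0 with rfl | h
    · simp
    · simp [Real.rpow_neg_one, h]
  have h1 : P * (1 - Q) = 0 := (key _).1 (by rw [mul_sub, hAQ, mul_one, sub_self])
  have h2 : A * (1 - P) = 0 := (key _).2 (by rw [mul_sub, hPP, mul_one, sub_self])
  have h3 : Q * (1 - P) = 0 := by rw [hQ, mul_assoc, h2, mul_zero]
  rw [mul_sub, mul_one, sub_eq_zero] at h1 h3
  have h4 := congrArg conjTranspose h1
  rw [conjTranspose_mul, hQh, hP.eq, ← h3] at h4
  exact h4.symm

lemma exists_unitary_rpow_eq {A : Matrix n n ℂ} (hA : A.PosDef) :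
    ∃ (U : Matrix n n ℂ) (a : n → ℝ), U * Uᴴ = 1 ∧ Uᴴ * U = 1 ∧ (∀ i, 0 < a i) ∧
      ∀ r : ℝ, A ^ r = U * diagonal (fun i => ((a i ^ r : ℝ) : ℂ)) * Uᴴ := by
  refine ⟨hA.1.eigenvectorUnitary, hA.1.eigenvalues, ?_, ?_, hA.eigenvalues_pos, fun r => ?_⟩
  · exact Unitary.mul_star_self_of_mem hA.1.eigenvectorUnitary.2
  · exact Unitary.star_mul_self_of_mem hA.1.eigenvectorUnitary.2
  · rw [CFC.rpow_eq_cfc_real hA.posSemidef.nonneg, ← mfun_eq_cfc _ hA.1, mfun, dif_pos hA.1]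
    rfl

lemma trace_diagonal_mul_mul_diagonal_mul (d e : n → ℝ) (M N : Matrix n n ℂ) :
    (diagonal (fun i => (d i : ℂ)) * M * diagonal (fun i => (e i : ℂ)) * Nᴴ).trace.re =
      ∑ i, ∑ j, d i * e j * ((M i j).re * (N i j).re + (M i j).im * (N i j).im) := by
  simp only [trace, diag_apply, mul_apply (N := Nᴴ), mul_diagonal, diagonal_mul,
    conjTranspose_apply, Complex.re_sum]
  refine Finset.sum_congr rfl fun i _ => Finset.sum_congr rfl fun j _ => ?_
  simp
  ring

lemma rpow_quadratic_nonneg {s t a : ℝ} (hs : 0 < s) (hs1 : s ≤ 1) (ht : 0 < t) (ha : 0 < a)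
    (w l : ℝ) :
    0 ≤ t ^ (1 + s) * a ^ (-s) * (w * w) - 2 * (t * (l * w)) +
      ((1 - s) * t + s * a) * (l * l) := by
  have h1 : t ^ (1 - s) * a ^ s ≤ (1 - s) * t + s * a :=
    Real.geom_mean_le_arith_mean2_weighted (by linarith) hs.le ht.le ha.le (by ring)
  have hc : 0 < t ^ (1 - s) * a ^ s := by positivity
  have h2 : t ^ (1 + s) * a ^ (-s) * (t ^ (1 - s) * a ^ s) = t * t := by
    have e1 : t ^ (1 + s) * t ^ (1 - s) = t * t := by
      rw [← Real.rpow_add ht, show 1 + s + (1 - s) = (2 : ℕ) by push_cast; ring,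
        Real.rpow_natCast, sq]
    have e2 : a ^ (-s) * a ^ s = 1 := by rw [← Real.rpow_add ha]; simp
    linear_combination a ^ (-s) * a ^ s * e1 + t * t * e2
  set c := t ^ (1 - s) * a ^ s
  set b := t ^ (1 + s) * a ^ (-s)
  have h3 : 0 ≤ b * (w * w) - 2 * (t * (l * w)) + c * (l * l) := by
    refine nonneg_of_mul_nonneg_right (a := c) ?_ hc
    have : c * (b * (w * w) - 2 * (t * (l * w)) + c * (l * l)) = (t * w - c * l) ^ 2 := by
      linear_combination (w * w) * h2
    rw [this]; positivity
  nlinarith [mul_self_nonneg l]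

lemma trace_mul_nonneg_of_nonneg {A B : Matrix n n ℂ} (hA : A.PosSemidef) (hB : B.PosSemidef) :
    0 ≤ (A * B).trace.re := by
  obtain ⟨C, rfl⟩ := CStarAlgebra.nonneg_iff_eq_star_mul_self.1 hA.nonneg
  rw [star_eq_conjTranspose, Matrix.mul_assoc, Matrix.trace_mul_comm]
  exact (Complex.le_def.1 (hB.mul_mul_conjTranspose_same C).trace_nonneg).1

lemma trace_mul_mul_self_le {L A : Matrix n n ℂ} (hL : L.PosSemidef) (hL1 : (1 - L).PosSemidef)
    (hA : A.PosSemidef) : (L * A * L).trace.re ≤ (L * A).trace.re := by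
  have h : (L * (1 - L)).PosSemidef :=
    (Commute.mul_nonneg hL.nonneg hL1.nonneg
      ((Commute.one_right L).sub_right (Commute.refl L))).posSemidef
  have h2 := trace_mul_nonneg_of_nonneg h hA
  have h3 : (L * A * L).trace = (L * L * A).trace := by
    rw [Matrix.trace_mul_comm, Matrix.mul_assoc]
  rw [h3]
  rw [mul_sub, mul_one, sub_mul, trace_sub, Complex.sub_re] at h2
  linarith

lemma trace_rpow_mul_rpow_ge {L T A : Matrix n n ℂ} (hT : T.PosDef) (hA : A.PosDef)
    (hL : L.PosSemidef) (hL1 : (1 - L).PosSemidef) {s : ℝ} (hs : 0 < s) (hs1 : s ≤ 1) :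
    (1 + s) * (L * T).trace.re - s * (L * A).trace.re ≤
      (T ^ (1 + s) * A ^ (-s)).trace.re := by
  obtain ⟨U, t, hU, hU', ht, hTr⟩ := exists_unitary_rpow_eq hT
  obtain ⟨V, a, hV, hV', ha, hAr⟩ := exists_unitary_rpow_eq hA
  have hT1 := hTr 1
  have hA1 := hAr 1
  rw [CFC.rpow_one T hT.posSemidef.nonneg] at hT1
  rw [CFC.rpow_one A hA.posSemidef.nonneg] at hA1
  simp only [Real.rpow_one] at hT1 hA1
  have hLh : Lᴴ = L := hL.1
  have e1 : (T ^ (1 + s) * A ^ (-s)).trace.re = ∑ i, ∑ j, t i ^ (1 + s) * a j ^ (-s) *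
      (((Uᴴ * V) i j).re * ((Uᴴ * V) i j).re + ((Uᴴ * V) i j).im * ((Uᴴ * V) i j).im) := by
    rw [← trace_diagonal_mul_mul_diagonal_mul, hTr, hAr, Matrix.mul_assoc U,
      Matrix.mul_assoc U, Matrix.trace_mul_comm U]
    simp only [conjTranspose_mul, conjTranspose_conjTranspose, Matrix.mul_assoc]
  have e2 : (L * T).trace.re = ∑ i, ∑ j, t i * (fun _ => 1 : n → ℝ) j *
      (((Uᴴ * L * V) i j).re * ((Uᴴ * V) i j).re +
        ((Uᴴ * L * V) i j).im * ((Uᴴ * V) i j).im) := by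
    rw [← trace_diagonal_mul_mul_diagonal_mul, Matrix.trace_mul_comm L, hT1, Matrix.mul_assoc U,
      Matrix.mul_assoc U, Matrix.trace_mul_comm U]
    simp only [conjTranspose_mul, conjTranspose_conjTranspose, Matrix.mul_assoc,
      Complex.ofReal_one, diagonal_one, Matrix.one_mul]
    rw [← Matrix.mul_assoc V Vᴴ, hV, Matrix.one_mul]
  have e3 : (L * T * L).trace.re = ∑ i, ∑ j, t i * (fun _ => 1 : n → ℝ) j *
      (((Uᴴ * L * V) i j).re * ((Uᴴ * L * V) i j).re +
        ((Uᴴ * L * V) i j).im * ((Uᴴ * L * V) i j).im) := by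
    rw [← trace_diagonal_mul_mul_diagonal_mul, hT1]
    simp only [conjTranspose_mul, conjTranspose_conjTranspose, Matrix.mul_assoc,
      Complex.ofReal_one, diagonal_one, Matrix.one_mul, hLh]
    rw [← Matrix.mul_assoc V Vᴴ, hV, Matrix.one_mul, ← Matrix.mul_assoc L U,
      Matrix.trace_mul_comm (L * U)]
    simp only [Matrix.mul_assoc]
  have e4 : (L * A * L).trace.re = ∑ i, ∑ j, (fun _ => 1 : n → ℝ) i * a j *
      (((Uᴴ * L * V) i j).re * ((Uᴴ * L * V) i j).re +
        ((Uᴴ * L * V) i j).im * ((Uᴴ * L * V) i j).im) := by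
    rw [← trace_diagonal_mul_mul_diagonal_mul, hA1]
    simp only [conjTranspose_mul, conjTranspose_conjTranspose, Matrix.mul_assoc,
      Complex.ofReal_one, diagonal_one, Matrix.one_mul, hLh]
    rw [Matrix.trace_mul_comm Uᴴ]
    simp only [Matrix.mul_assoc, hU, Matrix.mul_one]
  have h1 := trace_mul_mul_self_le hL hL1 hT.posSemidef
  have h2 := trace_mul_mul_self_le hL hL1 hA.posSemidef
  have h3 : 0 ≤ (T ^ (1 + s) * A ^ (-s)).trace.re - 2 * (L * T).trace.re +
      ((1 - s) * (L * T * L).trace.re + s * (L * A * L).trace.re) := by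
    rw [e1, e2, e3, e4]
    simp only [Finset.mul_sum, ← Finset.sum_sub_distrib, ← Finset.sum_add_distrib]
    refine Finset.sum_nonneg fun i _ => Finset.sum_nonneg fun j _ => ?_
    have q1 := rpow_quadratic_nonneg hs hs1 (ht i) (ha j) ((Uᴴ * V) i j).re ((Uᴴ * L * V) i j).re
    have q2 := rpow_quadratic_nonneg hs hs1 (ht i) (ha j) ((Uᴴ * V) i j).im ((Uᴴ * L * V) i j).im
    linarith
  have h4 := mul_le_mul_of_nonneg_left h1 (sub_nonneg.2 hs1)
  have h5 := mul_le_mul_of_nonneg_left h2 hs.le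
  linarith

lemma trace_sum_rpow_le {ι : Type*} [Fintype ι] [Nonempty ι] {A Λ : ι → Matrix n n ℂ}
    (hA : ∀ x, (A x).PosDef) (hΛ : ∀ x, (Λ x).PosSemidef) (hsum : ∑ x, Λ x = 1)
    {s : ℝ} (hs : 0 < s) :
    ((∑ x, A x ^ (-s)) ^ (-(1 / s))).trace.re ≤ ∑ x, (Λ x * A x).trace.re := by
  set S := ∑ x, A x ^ (-s) with hS
  have hAs : ∀ x, IsStrictlyPositive (A x ^ (-s)) := fun x =>
    IsStrictlyPositive.rpow _ _ (Matrix.isStrictlyPositive_iff_posDef.2 (hA x))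
  have hle : ∀ x, A x ^ (-s) ≤ S := fun x =>
    Finset.single_le_sum (f := fun x => A x ^ (-s)) (fun y _ => (hAs y).nonneg)
      (Finset.mem_univ x)
  have hSp : IsStrictlyPositive S := (hAs (Classical.arbitrary ι)).of_le (hle _)
  set T := S ^ (-(1 / s)) with hT
  have hTp : IsStrictlyPositive T := IsStrictlyPositive.rpow _ _ hSp
  have hTd := Matrix.isStrictlyPositive_iff_posDef.1 hTp
  have htr : T.trace.re = ∑ x, (Λ x * T).trace.re := by
    rw [← Complex.re_sum, ← trace_sum, ← Finset.sum_mul, hsum, Matrix.one_mul]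
  rcases le_total s 1 with h1 | h1
  · have hkey : ∀ x, (1 + s) * (Λ x * T).trace.re - s * (Λ x * A x).trace.re ≤
        (T ^ (1 + s) * A x ^ (-s)).trace.re := fun x => by
      refine trace_rpow_mul_rpow_ge hTd (hA x) (hΛ x) ?_ hs h1
      rw [← hsum, ← Matrix.nonneg_iff_posSemidef, sub_nonneg]
      exact Finset.single_le_sum (f := Λ) (fun y _ => (hΛ y).nonneg) (Finset.mem_univ x)
    have h := Finset.sum_le_sum fun x (_ : x ∈ Finset.univ) => hkey x
    rw [← Complex.re_sum, ← trace_sum, ← Finset.mul_sum, ← hS, Finset.sum_sub_distrib,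
      ← Finset.mul_sum, ← Finset.mul_sum, ← htr] at h
    have h2 : T ^ (1 + s) * S = T := by
      have hne : -(1 / s) * (1 + s) + 1 = -(1 / s) := by field_simp; ring
      have hmul := matrix_rpow_mul_rpow hSp.nonneg (x := -(1 / s) * (1 + s)) (y := 1)
        (by rw [hne]; simp [hs.ne'])
      rwa [hne, CFC.rpow_one S hSp.nonneg, ← matrix_rpow_rpow hSp.nonneg] at hmul
    rw [h2] at h
    nlinarith
  · have hTA : ∀ x, T ≤ A x := fun x => by
      have h2 : (A x ^ (-s)) ^ (1 / s) ≤ S ^ (1 / s) :=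
        CFC.rpow_le_rpow ⟨by positivity, by rw [div_le_one hs]; exact h1⟩ (hle x)
      have h3 := CStarAlgebra.rpow_neg_one_le_rpow_neg_one h2
        (IsStrictlyPositive.rpow _ (1 / s) (hAs x))
      rw [matrix_rpow_rpow (hA x).posSemidef.nonneg, matrix_rpow_rpow (hA x).posSemidef.nonneg,
        matrix_rpow_rpow hSp.nonneg] at h3
      have e : -s * (1 / s) * -1 = 1 := by field_simp
      rw [e, CFC.rpow_one _ (hA x).posSemidef.nonneg, mul_neg_one] at h3
      exact h3
    rw [htr]
    refine Finset.sum_le_sum fun x _ => ?_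
    have h2 := trace_mul_nonneg_of_nonneg (hΛ x)
      (Matrix.nonneg_iff_posSemidef.1 (sub_nonneg.2 (hTA x)))
    rw [mul_sub, trace_sub, Complex.sub_re] at h2
    linarith

/-- The orthogonal projection onto the kernel of a positive semidefinite matrix. -/
noncomputable def kerProj (A : Matrix n n ℂ) : Matrix n n ℂ :=
  cfc (fun t : ℝ => if t = 0 then 1 else 0) A

lemma kerProj_nonneg (A : Matrix n n ℂ) : 0 ≤ kerProj A :=
  cfc_nonneg fun t _ => by split_ifs <;> simp

lemma kerProj_mul_kerProj (A : Matrix n n ℂ) : kerProj A * kerProj A = kerProj A := by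
  rw [kerProj, ← cfc_mul _ _ A (continuousOn_real_spectrum A _) (continuousOn_real_spectrum A _)]
  exact cfc_congr fun t _ => by simp

lemma kerProj_mul_self {A : Matrix n n ℂ} (hA : 0 ≤ A) : kerProj A * A = 0 := by
  nth_rewrite 2 [← cfc_id' ℝ A (IsSelfAdjoint.of_nonneg hA)]
  rw [kerProj, ← cfc_mul _ _ A (continuousOn_real_spectrum A _) (continuousOn_real_spectrum A _),
    ← cfc_const_zero ℝ A]
  exact cfc_congr fun t _ => by simp

lemma one_sub_kerProj {A : Matrix n n ℂ} (hA : 0 ≤ A) {r : ℝ} (hr : r ≠ 0) :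
    1 - kerProj A = A ^ r * A ^ (-r) := by
  rw [CFC.rpow_eq_cfc_real hA, CFC.rpow_eq_cfc_real hA, kerProj,
    ← cfc_one ℝ A (IsSelfAdjoint.of_nonneg hA),
    ← cfc_mul _ _ A (continuousOn_real_spectrum A _) (continuousOn_real_spectrum A _),
    ← cfc_sub _ _ A (continuousOn_real_spectrum A _) (continuousOn_real_spectrum A _)]
  refine cfc_congr fun t ht => ?_
  have ht0 : 0 ≤ t := spectrum_nonneg_of_nonneg hA ht
  rcases ht0.eq_or_lt with rfl | h
  · simp [Real.zero_rpow hr]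
  · simp [h.ne', ← Real.rpow_add h]

lemma kerProj_mulVec_eq_zero_iff {A : Matrix n n ℂ} (hA : 0 ≤ A) (v : n → ℂ) :
    kerProj A *ᵥ v = 0 ↔ v ∈ LinearMap.range A.mulVecLin := by
  constructor
  · intro h
    have h1 := one_sub_kerProj hA one_ne_zero
    rw [CFC.rpow_one A hA] at h1
    refine ⟨A ^ (-1 : ℝ) *ᵥ v, ?_⟩
    rw [mulVecLin_apply, mulVec_mulVec, ← h1, sub_mulVec, one_mulVec, h, sub_zero]
  · rintro ⟨w, rfl⟩
    rw [mulVecLin_apply, mulVec_mulVec, kerProj_mul_self hA, zero_mulVec]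

lemma add_smul_one_rpow {A : Matrix n n ℂ} (hA : 0 ≤ A) {ε : ℝ} (hε : 0 ≤ ε) (r : ℝ) :
    (A + ε • (1 : Matrix n n ℂ)) ^ r = cfc (fun t : ℝ => (t + ε) ^ r) A := by
  have hsa := IsSelfAdjoint.of_nonneg hA
  have h1 : A + ε • (1 : Matrix n n ℂ) = cfc (fun t : ℝ => t + ε) A := by
    rw [cfc_add_const ε (fun t : ℝ => t) A (continuousOn_real_spectrum A _) hsa,
      cfc_id' ℝ A hsa, Algebra.algebraMap_eq_smul_one]
  have hnn : 0 ≤ A + ε • (1 : Matrix n n ℂ) :=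
    add_nonneg hA (smul_nonneg hε zero_le_one)
  rw [CFC.rpow_eq_cfc_real hnn, h1, ← cfc_comp' (fun t : ℝ => t ^ r) (fun t : ℝ => t + ε) A
    (((Matrix.finite_real_spectrum (A := A)).image _).continuousOn _)
    (continuousOn_real_spectrum A _) hsa]

lemma tendsto_cfc_of_pointwise {A : Matrix n n ℂ} (hA : 0 ≤ A) {β : Type*} {l : Filter β}
    {f : β → ℝ → ℝ} {g : ℝ → ℝ} (h : ∀ t, 0 ≤ t → Tendsto (fun b => f b t) l (𝓝 (g t))) :
    Tendsto (fun b => cfc (f b) A) l (𝓝 (cfc g A)) := by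
  have hh := hA.posSemidef.1
  simp only [← mfun_eq_cfc _ hh, mfun, dif_pos hh]
  have hd : Tendsto (fun b => diagonal fun i => ((f b (hh.eigenvalues i) : ℝ) : ℂ)) l
      (𝓝 (diagonal fun i => ((g (hh.eigenvalues i) : ℝ) : ℂ))) := by
    have hc : Continuous fun d : n → ℂ => diagonal d := continuous_id.matrix_diagonal
    refine (hc.tendsto _).comp (tendsto_pi_nhds.2 fun i => ?_)
    exact (Complex.continuous_ofReal.tendsto _).comp (h _ (hA.posSemidef.eigenvalues_nonneg i))
  exact (tendsto_const_nhds.mul hd).mul tendsto_const_nhds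

lemma tendsto_add_smul_one_rpow {A : Matrix n n ℂ} (hA : 0 ≤ A) {s : ℝ} (hs : 0 < s) :
    Tendsto (fun ε : ℝ => (A + ε • (1 : Matrix n n ℂ)) ^ s) (𝓝[>] 0) (𝓝 (A ^ s)) := by
  rw [CFC.rpow_eq_cfc_real hA]
  refine (tendsto_cfc_of_pointwise (f := fun ε t => (t + ε) ^ s) hA fun t _ => ?_).congr' ?_
  · have hc : Continuous fun ε : ℝ => (t + ε) ^ s :=
      (continuous_const.add continuous_id).rpow_const fun _ => Or.inr hs.le
    have := hc.tendsto 0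
    rw [add_zero] at this
    exact this.mono_left nhdsWithin_le_nhds
  · filter_upwards [self_mem_nhdsWithin] with ε hε
    exact (add_smul_one_rpow hA (le_of_lt hε) s).symm

lemma tendsto_add_smul_one_rpow_neg_sub {A : Matrix n n ℂ} (hA : 0 ≤ A) {s : ℝ} (hs : 0 < s) :
    Tendsto (fun ε : ℝ => (A + ε • (1 : Matrix n n ℂ)) ^ (-s) - ε ^ (-s) • kerProj A)
      (𝓝[>] 0) (𝓝 (A ^ (-s))) := by
  rw [CFC.rpow_eq_cfc_real hA]
  refine (tendsto_cfc_of_pointwise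
    (f := fun ε t => (t + ε) ^ (-s) - ε ^ (-s) * (if t = 0 then 1 else 0)) hA
    fun t ht => ?_).congr' ?_
  · rcases ht.eq_or_lt with rfl | ht
    · simp [Real.zero_rpow (neg_ne_zero.2 hs.ne')]
    · have hc : ContinuousAt (fun ε : ℝ => (t + ε) ^ (-s)) 0 :=
        (continuousAt_const.add continuousAt_id).rpow_const (Or.inl (by simp [ht.ne']))
      have := hc.tendsto
      rw [add_zero] at this
      simpa [ht.ne'] using this.mono_left nhdsWithin_le_nhds
  · filter_upwards [self_mem_nhdsWithin] with ε hε
    rw [add_smul_one_rpow hA (le_of_lt hε), kerProj,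
      ← cfc_const_mul _ _ A (continuousOn_real_spectrum A _),
      cfc_sub _ _ A (continuousOn_real_spectrum A _) (continuousOn_real_spectrum A _)]

lemma smul_kerProj_le {A : Matrix n n ℂ} (hA : 0 ≤ A) {ε : ℝ} (hε : 0 ≤ ε) (r : ℝ) :
    ε ^ r • kerProj A ≤ (A + ε • (1 : Matrix n n ℂ)) ^ r := by
  rw [add_smul_one_rpow hA hε, kerProj, ← cfc_const_mul _ _ A (continuousOn_real_spectrum A _)]
  refine cfc_mono (fun t ht => ?_) (continuousOn_real_spectrum A _)
    (continuousOn_real_spectrum A _)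
  have ht0 : 0 ≤ t := spectrum_nonneg_of_nonneg hA ht
  split_ifs with h
  · simp [h]
  · rw [mul_zero]; positivity

lemma norm_mul_sq_le_of_smul_le {K S T : Matrix n n ℂ} (hK : 0 ≤ K) (hKK : K * K = K)
    (hT : 0 ≤ T) (hST : S * T = 1) {c : ℝ} (hc : 0 < c) (h : c • K ≤ S) :
    ‖K * T‖ ^ 2 ≤ c⁻¹ * ‖T‖ := by
  have hTs : star T = T := (IsSelfAdjoint.of_nonneg hT).star_eq
  have hKs : star K = K := (IsSelfAdjoint.of_nonneg hK).star_eq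
  have h1 : c • (T * K * T) ≤ T := by
    have := star_left_conjugate_le_conjugate h T
    rwa [hTs, mul_assoc T S, hST, mul_one, mul_smul_comm, smul_mul_assoc] at this
  have h2 : T * K * T ≤ c⁻¹ • T := by
    have := smul_le_smul_of_nonneg_left h1 (inv_nonneg.2 hc.le)
    rwa [smul_smul, inv_mul_cancel₀ hc.ne', one_smul] at this
  have h0 : 0 ≤ T * K * T := by
    have := star_left_conjugate_nonneg hK T
    rwa [hTs] at this
  have h3 := CStarAlgebra.norm_le_norm_of_nonneg_of_le h0 h2
  rw [norm_smul, Real.norm_of_nonneg (inv_nonneg.2 hc.le)] at h3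
  have h4 : star (K * T) * (K * T) = T * K * T := by
    rw [star_mul, hTs, hKs, mul_assoc, ← mul_assoc K, hKK, mul_assoc]
  rw [sq, ← CStarRing.norm_star_mul_self, h4]
  exact h3

lemma one_sub_mulVec_eq_zero_iff {P : Matrix n n ℂ} (hPP : P * P = P) (v : n → ℂ) :
    (1 - P) *ᵥ v = 0 ↔ v ∈ LinearMap.range P.mulVecLin := by
  rw [sub_mulVec, one_mulVec, sub_eq_zero]
  constructor
  · intro h
    exact ⟨v, h.symm⟩
  · rintro ⟨w, rfl⟩
    rw [mulVecLin_apply, mulVec_mulVec, hPP]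

lemma sum_mulVec_eq_zero_iff {m ι : Type*} [Fintype m] [Fintype ι] {A : ι → Matrix m m ℂ}
    (hA : ∀ x, 0 ≤ A x) (v : m → ℂ) : (∑ x, A x) *ᵥ v = 0 ↔ ∀ x, A x *ᵥ v = 0 := by
  have hs : 0 ≤ ∑ x, A x := Finset.sum_nonneg fun x _ => hA x
  rw [← hs.posSemidef.dotProduct_mulVec_zero_iff, sum_mulVec, dotProduct_sum,
    Finset.sum_eq_zero_iff_of_nonneg fun x _ => (hA x).posSemidef.dotProduct_mulVec_nonneg v]
  simp [(hA _).posSemidef.dotProduct_mulVec_zero_iff]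

section Limit

variable {ι : Type*} {C : ι → Matrix n n ℂ} {P : Matrix n n ℂ}

lemma rpow_neg_one_mul_sum_kerProj [Fintype ι] (hC : ∀ x, 0 ≤ C x) (hP : P.IsHermitian) (hPP : P * P = P)
    (hr : LinearMap.range P.mulVecLin = ⨅ x, LinearMap.range (C x).mulVecLin) :
    (∑ x, kerProj (C x)) ^ (-1 : ℝ) * ∑ x, kerProj (C x) = 1 - P := by
  refine rpow_neg_one_mul_self_eq (Finset.sum_nonneg fun x _ => kerProj_nonneg _)
    (isHermitian_one.sub hP) (by rw [mul_sub, sub_mul, sub_mul, hPP]; simp) fun v => ?_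
  rw [sum_mulVec_eq_zero_iff fun x => kerProj_nonneg _, one_sub_mulVec_eq_zero_iff hPP, hr,
    Submodule.mem_iInf]
  exact forall_congr' fun x => kerProj_mulVec_eq_zero_iff (hC x) v

lemma kerProj_mul_eq_zero (hC : ∀ x, 0 ≤ C x)
    (hr : LinearMap.range P.mulVecLin = ⨅ x, LinearMap.range (C x).mulVecLin) (x : ι) :
    kerProj (C x) * P = 0 := by
  refine Matrix.ext_of_mulVec_single fun i => ?_
  rw [zero_mulVec, ← mulVec_mulVec, kerProj_mulVec_eq_zero_iff (hC x)]
  have : P *ᵥ Pi.single i 1 ∈ LinearMap.range P.mulVecLin := ⟨_, rfl⟩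
  rw [hr, Submodule.mem_iInf] at this
  exact this x

lemma sum_rpow_nonneg [Fintype ι] (A : ι → Matrix n n ℂ) (r : ℝ) : 0 ≤ ∑ x, A x ^ r :=
  Finset.sum_nonneg fun _ _ => CFC.rpow_nonneg

lemma compress_sum_rpow_nonneg [Fintype ι] (hP : P.IsHermitian) (r : ℝ) :
    0 ≤ P * (∑ x, C x ^ r) * P := by
  have h := star_left_conjugate_nonneg (sum_rpow_nonneg C r) P
  rwa [star_eq_conjTranspose, hP.eq] at h

lemma compress_rpow_neg_one_mul_self [Fintype ι] [Nonempty ι] (hC : ∀ x, 0 ≤ C x) (hP : P.IsHermitian) (hPP : P * P = P)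
    (hr : LinearMap.range P.mulVecLin = ⨅ x, LinearMap.range (C x).mulVecLin)
    {s : ℝ} (hs : 0 < s) :
    (P * (∑ x, C x ^ (-s)) * P) ^ (-1 : ℝ) * (P * (∑ x, C x ^ (-s)) * P) = P := by
  have hB : ∀ x, 0 ≤ C x ^ (-s) := fun x => CFC.rpow_nonneg
  refine rpow_neg_one_mul_self_eq (compress_sum_rpow_nonneg hP _) hP hPP fun v => ?_
  constructor
  · intro h
    have h1 : star (P *ᵥ v) ⬝ᵥ ((∑ x, C x ^ (-s)) *ᵥ (P *ᵥ v)) = 0 := by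
      have := congrArg (fun w => star v ⬝ᵥ w) h
      simp only [dotProduct_zero] at this
      rw [star_mulVec, hP.eq, ← dotProduct_mulVec, mulVec_mulVec, mulVec_mulVec]
      exact this
    rw [(sum_rpow_nonneg C (-s)).posSemidef.dotProduct_mulVec_zero_iff, sum_mulVec_eq_zero_iff hB] at h1
    let x := Classical.arbitrary ι
    have h2 := congrArg (fun w => C x ^ s *ᵥ w) (h1 x)
    simp only [mulVec_mulVec, mulVec_zero] at h2
    rwa [← mul_assoc, ← one_sub_kerProj (hC x) hs.ne', sub_mul, one_mul,
      kerProj_mul_eq_zero hC hr x, sub_zero] at h2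
  · intro h
    rw [← mulVec_mulVec, h, mulVec_zero]

lemma compress_rpow_neg_one_mul [Fintype ι] [Nonempty ι] (hC : ∀ x, 0 ≤ C x)
    (hP : P.IsHermitian) (hPP : P * P = P)
    (hr : LinearMap.range P.mulVecLin = ⨅ x, LinearMap.range (C x).mulVecLin)
    {s : ℝ} (hs : 0 < s) :
    (P * (∑ x, C x ^ (-s)) * P) ^ (-1 : ℝ) * P = (P * (∑ x, C x ^ (-s)) * P) ^ (-1 : ℝ) := by
  have hMM := compress_rpow_neg_one_mul_self hC hP hPP hr hs
  have hM := compress_sum_rpow_nonneg (C := C) hP (-s)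
  set M := P * (∑ x, C x ^ (-s)) * P
  have h1 := matrix_rpow_mul_rpow hM (x := -1) (y := -1) (by norm_num)
  have h2 := matrix_rpow_mul_rpow hM (x := -1 + -1) (y := 1) (by norm_num)
  rw [CFC.rpow_one _ hM, ← h1, mul_assoc, hMM, show (-1 + -1 + 1 : ℝ) = -1 by norm_num] at h2
  exact h2

lemma mul_sum_kerProj_eq_zero [Fintype ι] (hC : ∀ x, 0 ≤ C x) (hP : P.IsHermitian)
    (hr : LinearMap.range P.mulVecLin = ⨅ x, LinearMap.range (C x).mulVecLin) :
    P * ∑ x, kerProj (C x) = 0 := by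
  have h1 : (∑ x, kerProj (C x)) * P = 0 := by
    rw [Finset.sum_mul, Finset.sum_eq_zero fun x _ => kerProj_mul_eq_zero hC hr x]
  have h0 : 0 ≤ ∑ x, kerProj (C x) := Finset.sum_nonneg fun x _ => kerProj_nonneg (C x)
  have h2 := congrArg conjTranspose h1
  rwa [conjTranspose_mul, conjTranspose_zero, hP.eq, h0.posSemidef.1.eq] at h2

lemma isStrictlyPositive_add_smul_one {A : Matrix n n ℂ} (hA : 0 ≤ A) {ε : ℝ} (hε : 0 < ε) :
    IsStrictlyPositive (A + ε • (1 : Matrix n n ℂ)) :=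
  IsStrictlyPositive.nonneg_add hA (IsStrictlyPositive.smul hε isStrictlyPositive_one)

lemma rpow_le_sum_rpow [Fintype ι] (A : ι → Matrix n n ℂ) (r : ℝ) (x : ι) :
    A x ^ r ≤ ∑ y, A y ^ r :=
  Finset.single_le_sum (f := fun y => A y ^ r) (fun _ _ => CFC.rpow_nonneg) (Finset.mem_univ x)

lemma isStrictlyPositive_sum_rpow [Fintype ι] [Nonempty ι] {A : ι → Matrix n n ℂ}
    (hA : ∀ x, IsStrictlyPositive (A x)) (r : ℝ) : IsStrictlyPositive (∑ x, A x ^ r) :=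
  (IsStrictlyPositive.rpow _ r (hA (Classical.arbitrary ι))).of_le (rpow_le_sum_rpow A r _)

lemma isBoundedUnder_norm_sum_rpow_rpow_neg_one [Fintype ι] [Nonempty ι]
    (hC : ∀ x, 0 ≤ C x) {s : ℝ} (hs : 0 < s) :
    IsBoundedUnder (· ≤ ·) (𝓝[>] (0 : ℝ)) fun ε : ℝ =>
      ‖(∑ x, (C x + ε • (1 : Matrix n n ℂ)) ^ (-s)) ^ (-1 : ℝ)‖ := by
  let x₀ := Classical.arbitrary ι
  refine (tendsto_add_smul_one_rpow (hC x₀) hs).norm.isBoundedUnder_le.mono_le ?_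
  filter_upwards [self_mem_nhdsWithin] with ε hε
  have h0 := isStrictlyPositive_add_smul_one (hC x₀) hε
  have h1 := CStarAlgebra.rpow_neg_one_le_rpow_neg_one
    (rpow_le_sum_rpow (fun x => C x + ε • (1 : Matrix n n ℂ)) (-s) x₀)
    (IsStrictlyPositive.rpow _ (-s) h0)
  rw [matrix_rpow_rpow h0.nonneg, neg_mul_neg, mul_one] at h1
  exact CStarAlgebra.norm_le_norm_of_nonneg_of_le CFC.rpow_nonneg h1

lemma tendsto_kerProj_mul_sum_rpow_rpow_neg_one [Fintype ι] [Nonempty ι]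
    (hC : ∀ x, 0 ≤ C x) {s : ℝ} (hs : 0 < s) (x : ι) :
    Tendsto (fun ε : ℝ => kerProj (C x) *
      (∑ x, (C x + ε • (1 : Matrix n n ℂ)) ^ (-s)) ^ (-1 : ℝ)) (𝓝[>] 0) (𝓝 0) := by
  have hbdd := isBoundedUnder_norm_sum_rpow_rpow_neg_one hC hs
  have h0 : Tendsto (fun ε : ℝ => ε ^ s *
      ‖(∑ x, (C x + ε • (1 : Matrix n n ℂ)) ^ (-s)) ^ (-1 : ℝ)‖) (𝓝[>] 0) (𝓝 0) := by
    refine Tendsto.zero_mul_isBoundedUnder_le ?_ (by simpa [Function.comp_def] using hbdd)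
    have := (Real.continuous_rpow_const hs.le).tendsto 0
    rw [Real.zero_rpow hs.ne'] at this
    exact this.mono_left nhdsWithin_le_nhds
  have h1 : Tendsto (fun ε : ℝ => ‖kerProj (C x) *
      (∑ x, (C x + ε • (1 : Matrix n n ℂ)) ^ (-s)) ^ (-1 : ℝ)‖ ^ 2) (𝓝[>] 0) (𝓝 0) := by
    refine squeeze_zero' (Eventually.of_forall fun ε => by positivity) ?_ h0
    filter_upwards [self_mem_nhdsWithin] with ε hε
    have hε' : 0 < ε := hε
    have hS := isStrictlyPositive_sum_rpow
      (fun x => isStrictlyPositive_add_smul_one (hC x) hε') (-s)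
    have hST := CFC.rpow_mul_rpow_neg 1 hS
    rw [CFC.rpow_one _ hS.nonneg] at hST
    have := norm_mul_sq_le_of_smul_le (kerProj_nonneg (C x)) (kerProj_mul_kerProj _)
      CFC.rpow_nonneg hST (Real.rpow_pos_of_pos hε' (-s))
      ((smul_kerProj_le (hC x) hε'.le (-s)).trans
        (rpow_le_sum_rpow (fun x => C x + ε • (1 : Matrix n n ℂ)) (-s) x))
    rwa [← Real.rpow_neg hε'.le, neg_neg] at this
  rw [tendsto_zero_iff_norm_tendsto_zero]
  simpa using h1.sqrt

lemma tendsto_of_mul_eq_one {β : Type*} {l : Filter β} {S T K : β → Matrix n n ℂ}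
    {B M₀ : Matrix n n ℂ} (hPK : ∀ b, P * K b = 0) (hM₀P : M₀ * P = M₀)
    (hMM : M₀ * (P * B * P) = P) (hST : ∀ᶠ b in l, S b * T b = 1)
    (hB : Tendsto (fun b => S b - K b) l (𝓝 B))
    (hT : IsBoundedUnder (· ≤ ·) l ((‖·‖) ∘ T))
    (hR : Tendsto (fun b => (1 - P) * T b) l (𝓝 0)) : Tendsto T l (𝓝 M₀) := by
  have hB0 : Tendsto (fun b => S b - K b - B) l (𝓝 0) := tendsto_sub_nhds_zero_iff.2 hB
  have hDT : Tendsto (fun b => (S b - K b - B) * T b) l (𝓝 0) :=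
    hB0.zero_mul_isBoundedUnder_le hT
  have hlim : Tendsto (fun b => M₀ + (1 - P) * T b - M₀ * B * ((1 - P) * T b) -
      M₀ * ((S b - K b - B) * T b)) l (𝓝 (M₀ + 0 - M₀ * B * 0 - M₀ * 0)) :=
    ((hR.const_add M₀).sub (hR.const_mul (M₀ * B))).sub (hDT.const_mul M₀)
  rw [mul_zero, mul_zero, add_zero, sub_zero, sub_zero] at hlim
  refine hlim.congr' ?_
  filter_upwards [hST] with b hb
  have h1 : M₀ * (S b - K b) * T b = M₀ := by
    have : P * (S b - K b) = P * S b := by rw [mul_sub, hPK, sub_zero]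
    rw [← hM₀P, mul_assoc M₀, this, mul_assoc, mul_assoc, hb, mul_one]
  have h2 : M₀ * B * P = P := by
    conv_lhs => rw [← hM₀P]
    rwa [mul_assoc, mul_assoc, ← mul_assoc P]
  have h3 : M₀ * B * ((1 - P) * T b) = M₀ * B * T b - P * T b := by
    rw [← mul_assoc, mul_sub, mul_one, h2, sub_mul]
  have h4 : M₀ * ((S b - K b - B) * T b) = M₀ - M₀ * B * T b := by
    rw [← mul_assoc, mul_sub, sub_mul, h1]
  rw [h3, h4, sub_mul, one_mul]
  abel

lemma tendsto_sum_rpow_rpow_neg_one [Fintype ι] [Nonempty ι] (hC : ∀ x, 0 ≤ C x)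
    (hP : P.IsHermitian) (hPP : P * P = P)
    (hr : LinearMap.range P.mulVecLin = ⨅ x, LinearMap.range (C x).mulVecLin)
    {s : ℝ} (hs : 0 < s) :
    Tendsto (fun ε : ℝ => (∑ x, (C x + ε • (1 : Matrix n n ℂ)) ^ (-s)) ^ (-1 : ℝ)) (𝓝[>] 0)
      (𝓝 ((P * (∑ x, C x ^ (-s)) * P) ^ (-1 : ℝ))) := by
  refine tendsto_of_mul_eq_one (S := fun ε : ℝ => ∑ x, (C x + ε • (1 : Matrix n n ℂ)) ^ (-s))
    (K := fun ε : ℝ => ε ^ (-s) • ∑ x, kerProj (C x)) (fun ε => ?_)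
    (compress_rpow_neg_one_mul hC hP hPP hr hs)
    (compress_rpow_neg_one_mul_self hC hP hPP hr hs) ?_ ?_
    (isBoundedUnder_norm_sum_rpow_rpow_neg_one hC hs) ?_
  · rw [mul_smul_comm, mul_sum_kerProj_eq_zero hC hP hr, smul_zero]
  · filter_upwards [self_mem_nhdsWithin] with ε hε
    have hS := isStrictlyPositive_sum_rpow
      (fun x => isStrictlyPositive_add_smul_one (hC x) hε) (-s)
    have hST := CFC.rpow_mul_rpow_neg 1 hS
    rwa [CFC.rpow_one _ hS.nonneg] at hST
  · simp only [Finset.smul_sum, ← Finset.sum_sub_distrib]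
    exact tendsto_finsetSum Finset.univ fun x _ => tendsto_add_smul_one_rpow_neg_sub (hC x) hs
  · have h1 := tendsto_finsetSum Finset.univ fun x _ =>
      tendsto_kerProj_mul_sum_rpow_rpow_neg_one hC hs x
    have h2 := h1.const_mul ((∑ x, kerProj (C x)) ^ (-1 : ℝ))
    rw [Finset.sum_const_zero, mul_zero] at h2
    refine h2.congr fun ε => ?_
    rw [← Finset.sum_mul, ← mul_assoc, rpow_neg_one_mul_sum_kerProj hC hP hPP hr]

lemma tendsto_sum_rpow_rpow [Fintype ι] [Nonempty ι] (hC : ∀ x, 0 ≤ C x) (hP : P.IsHermitian) (hPP : P * P = P)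
    (hr : LinearMap.range P.mulVecLin = ⨅ x, LinearMap.range (C x).mulVecLin)
    {s : ℝ} (hs : 0 < s) :
    Tendsto (fun ε : ℝ => (∑ x, (C x + ε • (1 : Matrix n n ℂ)) ^ (-s)) ^ (-(1 / s))) (𝓝[>] 0)
      (𝓝 ((P * (∑ x, C x ^ (-s)) * P) ^ (-(1 / s)))) := by
  have hcont : ContinuousOn (fun A : Matrix n n ℂ => A ^ (1 / s)) {A | 0 ≤ A} := by
    have h := CFC.continuousOn_nnrpow (A := Matrix n n ℂ) ⟨1 / s, by positivity⟩
    refine h.congr fun A _ => ?_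
    exact (CFC.nnrpow_eq_rpow (show (0 : NNReal) < ⟨1 / s, by positivity⟩ from
      NNReal.coe_pos.1 (by change 0 < 1 / s; positivity))).symm
  have hmem : ∀ A : Matrix n n ℂ, A ^ (-1 : ℝ) ∈ {A : Matrix n n ℂ | 0 ≤ A} := fun A =>
    CFC.rpow_nonneg (a := A)
  have h := (hcont _ (hmem (P * (∑ x, C x ^ (-s)) * P))).tendsto.comp
    (tendsto_nhdsWithin_iff.2 ⟨tendsto_sum_rpow_rpow_neg_one hC hP hPP hr hs,
      Eventually.of_forall fun ε => hmem _⟩)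
  simp only [Function.comp_def] at h
  rw [matrix_rpow_rpow (compress_sum_rpow_nonneg hP _), neg_one_mul] at h
  refine h.congr fun ε => ?_
  rw [matrix_rpow_rpow (sum_rpow_nonneg _ _), neg_one_mul]

end Limit

end Aux

lemma tendsto_negLogE {β : Type*} {l : Filter β} {f : β → ℝ} {a : ℝ} (ha : 0 ≤ a)
    (hf : ∀ᶠ b in l, 0 < f b) (h : Tendsto f l (𝓝 a)) :
    Tendsto (fun b => negLogE (f b)) l (𝓝 (negLogE a)) := by
  have heq : (fun b => ((-Real.log (f b) : ℝ) : EReal)) =ᶠ[l] fun b => negLogE (f b) := by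
    filter_upwards [hf] with b hb
    rw [negLogE, if_neg hb.not_ge]
  refine Tendsto.congr' heq ?_
  rcases ha.eq_or_lt with rfl | ha
  · rw [negLogE, if_pos le_rfl]
    refine EReal.tendsto_coe_nhds_top_iff.2 (tendsto_neg_atBot_atTop.comp ?_)
    exact Real.tendsto_log_nhdsGT_zero.comp (tendsto_nhdsWithin_iff.2 ⟨h, hf⟩)
  · rw [negLogE, if_neg ha.not_ge]
    exact (continuous_coe_real_ereal.tendsto _).comp (h.log ha.ne').neg

lemma negLogE_antitone : Antitone negLogE := by
  intro x y hxy
  rw [negLogE, negLogE]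
  split_ifs with h1 h2
  · exact le_rfl
  · exact absurd (hxy.trans h1) h2
  · exact le_top
  · exact EReal.coe_le_coe_iff.2 (neg_le_neg (Real.log_le_log (not_le.1 ‹¬x ≤ 0›) hxy))

lemma exists_povm {n ι : Type*} [Fintype n] [DecidableEq n] [Fintype ι] [Nonempty ι] :
    ∃ Λ : ι → Matrix n n ℂ, (∀ x, (Λ x).PosSemidef) ∧ ∑ x, Λ x = 1 := by
  refine ⟨fun x => if x = Classical.arbitrary ι then 1 else 0, fun x => ?_, by simp⟩
  dsimp only
  split_ifs
  exacts [PosSemidef.one, PosSemidef.zero]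

section Main
open scoped MatrixOrder Matrix.Norms.L2Operator

lemma trace_limit_le {n ι : Type*} [Fintype n] [DecidableEq n] [Fintype ι] [Nonempty ι]
    {C Λ : ι → Matrix n n ℂ} {P : Matrix n n ℂ}
    (hC : ∀ x, 0 ≤ C x) (hP : P.IsHermitian) (hPP : P * P = P)
    (hr : LinearMap.range P.mulVecLin = ⨅ x, LinearMap.range (C x).mulVecLin)
    {s : ℝ} (hs : 0 < s) (hΛ : ∀ x, (Λ x).PosSemidef) (hsum : ∑ x, Λ x = 1) :
    ((P * (∑ x, C x ^ (-s)) * P) ^ (-(1 / s))).trace.re ≤ ∑ x, (Λ x * C x).trace.re := by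
  have htr : Continuous fun A : Matrix n n ℂ => A.trace.re :=
    Complex.continuous_re.comp continuous_id.matrix_trace
  have h1 := (htr.tendsto _).comp (tendsto_sum_rpow_rpow hC hP hPP hr hs)
  have h2 : Continuous fun ε : ℝ => ∑ x, (Λ x * (C x + ε • (1 : Matrix n n ℂ))).trace.re := by
    refine continuous_finsetSum _ fun x _ => htr.comp ?_
    exact continuous_const.mul (continuous_const.add (continuous_id.smul continuous_const))
  have h3 := (h2.tendsto 0).mono_left (nhdsWithin_le_nhds (s := Set.Ioi 0))
  simp only [zero_smul, add_zero] at h3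
  refine le_of_tendsto_of_tendsto h1 h3 ?_
  filter_upwards [self_mem_nhdsWithin] with ε hε
  exact trace_sum_rpow_le
    (fun x => Matrix.isStrictlyPositive_iff_posDef.1 (isStrictlyPositive_add_smul_one (hC x) hε))
    hΛ hsum hs

lemma range_smul_mulVecLin {n : Type*} [Fintype n] {c : ℝ} (hc : 0 < c) (A : Matrix n n ℂ) :
    LinearMap.range (c • A).mulVecLin = LinearMap.range A.mulVecLin := by
  have h : (c • A).mulVecLin = (c : ℂ) • A.mulVecLin := by
    ext v
    simp
  rw [h, LinearMap.range_smul _ _ (Complex.ofReal_ne_zero.2 hc.ne')]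

lemma perturbed_mpow_eq {n ι : Type*} [Fintype n] [DecidableEq n] [Fintype ι]
    {C : ι → Matrix n n ℂ} (hC : ∀ x, 0 ≤ C x) {s ε : ℝ} (hs : 0 < s) (hε : 0 ≤ ε) :
    mpow (∑ x, mpow (C x + ε • (1 : Matrix n n ℂ)) (-s)) (-(1 / s)) =
      (∑ x, (C x + ε • (1 : Matrix n n ℂ)) ^ (-s)) ^ (-(1 / s)) := by
  have h : ∀ x, mpow (C x + ε • (1 : Matrix n n ℂ)) (-s) =
      (C x + ε • (1 : Matrix n n ℂ)) ^ (-s) := fun x =>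
    mpow_eq_rpow (add_nonneg (hC x) (smul_nonneg hε zero_le_one)) (neg_ne_zero.2 hs.ne')
  simp only [h]
  exact mpow_eq_rpow (sum_rpow_nonneg _ _)
    (neg_ne_zero.2 (one_div_ne_zero hs.ne'))

lemma compressed_mpow_eq {n ι : Type*} [Fintype n] [DecidableEq n] [Fintype ι]
    {C : ι → Matrix n n ℂ} {P : Matrix n n ℂ} (hC : ∀ x, 0 ≤ C x) (hP : P.IsHermitian)
    {s : ℝ} (hs : 0 < s) :
    mpow (∑ x, P * mpow (C x) (-s) * P) (-(1 / s)) =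
      (P * (∑ x, C x ^ (-s)) * P) ^ (-(1 / s)) := by
  have h : ∀ x, mpow (C x) (-s) = C x ^ (-s) := fun x =>
    mpow_eq_rpow (hC x) (neg_ne_zero.2 hs.ne')
  simp only [h]
  rw [← Finset.sum_mul, ← Finset.mul_sum]
  exact mpow_eq_rpow (compress_sum_rpow_nonneg hP _) (neg_ne_zero.2 (one_div_ne_zero hs.ne'))

lemma tendsto_negLogE_trace {n ι : Type*} [Fintype n] [DecidableEq n] [Nonempty n] [Fintype ι]
    [Nonempty ι] {C : ι → Matrix n n ℂ} {P : Matrix n n ℂ}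
    (hC : ∀ x, 0 ≤ C x) (hP : P.IsHermitian) (hPP : P * P = P)
    (hr : LinearMap.range P.mulVecLin = ⨅ x, LinearMap.range (C x).mulVecLin)
    {s : ℝ} (hs : 0 < s) :
    Tendsto (fun ε : ℝ => negLogE
        ((mpow (∑ x, mpow (C x + ε • (1 : Matrix n n ℂ)) (-s)) (-(1 / s))).trace.re)) (𝓝[>] 0)
      (𝓝 (negLogE ((mpow (∑ x, P * mpow (C x) (-s) * P) (-(1 / s))).trace.re))) := by
  have htr : Continuous fun A : Matrix n n ℂ => A.trace.re :=
    Complex.continuous_re.comp continuous_id.matrix_trace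
  rw [compressed_mpow_eq hC hP hs]
  have hev : ∀ᶠ ε : ℝ in 𝓝[>] 0,
      mpow (∑ x, mpow (C x + ε • (1 : Matrix n n ℂ)) (-s)) (-(1 / s)) =
        (∑ x, (C x + ε • (1 : Matrix n n ℂ)) ^ (-s)) ^ (-(1 / s)) := by
    filter_upwards [self_mem_nhdsWithin] with ε hε
    exact perturbed_mpow_eq hC hs (le_of_lt hε)
  refine tendsto_negLogE ?_ ?_ (((htr.tendsto _).comp
    (tendsto_sum_rpow_rpow hC hP hPP hr hs)).congr' ?_)
  · have h : (0 : Matrix n n ℂ) ≤ (P * (∑ x, C x ^ (-s)) * P) ^ (-(1 / s)) := CFC.rpow_nonneg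
    exact (Complex.le_def.1 h.posSemidef.trace_nonneg).1
  · filter_upwards [hev, self_mem_nhdsWithin] with ε h hε
    rw [h]
    have hS := isStrictlyPositive_sum_rpow
      (fun x => isStrictlyPositive_add_smul_one (hC x) hε) (-s)
    have hpd := Matrix.isStrictlyPositive_iff_posDef.1 (IsStrictlyPositive.rpow _ (-(1 / s)) hS)
    exact (Complex.lt_def.1 hpd.trace_pos).1
  · filter_upwards [hev] with ε h
    rw [h]
    rfl

lemma trace_limit_le_Perr {n ι : Type*} [Fintype n] [DecidableEq n] [Fintype ι] [Nonempty ι]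
    {p : ι → ℝ} {ρ : ι → Matrix n n ℂ} {P : Matrix n n ℂ}
    (hC : ∀ x, 0 ≤ p x • ρ x) (hP : P.IsHermitian) (hPP : P * P = P)
    (hr : LinearMap.range P.mulVecLin = ⨅ x, LinearMap.range (p x • ρ x).mulVecLin)
    {s : ℝ} (hs : 0 < s) :
    (mpow (∑ x, P * mpow (p x • ρ x) (-s) * P) (-(1 / s))).trace.re ≤ Perr p ρ := by
  obtain ⟨Λ₀, hΛ₀, hsum₀⟩ := exists_povm (n := n) (ι := ι)
  refine le_csInf ⟨_, Λ₀, hΛ₀, hsum₀, rfl⟩ ?_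
  rintro _ ⟨Λ, hΛ, hsum, rfl⟩
  rw [compressed_mpow_eq hC hP hs]
  refine (trace_limit_le hC hP hPP hr hs hΛ hsum).trans_eq (Finset.sum_congr rfl fun x _ => ?_)
  rw [mul_smul_comm, trace_smul, Complex.real_smul, Complex.re_ofReal_mul]

end Main

/-- closed-form converse bound on the one-shot error probability
of state exclusion; `Pr` is the projector onto `⋂ₓ supp(ρₓ)`. -/
theorem state_exclusion_closed_form_converse
    {n ι : Type} [Fintype n] [DecidableEq n] [Fintype ι] [Nonempty ι]
    (p : ι → ℝ) (ρ : ι → Matrix n n ℂ)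
    (hp : ∀ x, 0 < p x) (hp1 : ∑ x, p x = 1) (hρ : ∀ x, IsState (ρ x))
    (α : ℝ) (hα : 1 < α)
    (Pr : Matrix n n ℂ) (hPrherm : Pr.IsHermitian) (hPrproj : Pr * Pr = Pr)
    (hPrrange : LinearMap.range Pr.mulVecLin = ⨅ x, LinearMap.range (ρ x).mulVecLin) :
    Filter.Tendsto
        (fun ε : ℝ => negLogE
          (((mpow (∑ x, mpow (p x • ρ x + ε • (1 : Matrix n n ℂ)) (1 - α))
            (1 / (1 - α))).trace).re))
        (𝓝[>] (0 : ℝ))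
        (𝓝 (negLogE
          (((mpow (∑ x, Pr * mpow (p x • ρ x) (1 - α) * Pr) (1 / (1 - α))).trace).re))) ∧
      negLogE (Perr p ρ) ≤
        negLogE
          (((mpow (∑ x, Pr * mpow (p x • ρ x) (1 - α) * Pr) (1 / (1 - α))).trace).re) := by
  have hC : ∀ x, (p x • ρ x).PosSemidef := fun x => (hρ x).1.smul (hp x).le
  have hr : LinearMap.range Pr.mulVecLin = ⨅ x, LinearMap.range (p x • ρ x).mulVecLin := by
    rw [hPrrange]
    exact iInf_congr fun x => (range_smul_mulVecLin (hp x) (ρ x)).symm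
  have hn : Nonempty n := by
    by_contra h
    rw [not_nonempty_iff] at h
    have := (hρ (Classical.arbitrary ι)).2
    simp [Matrix.trace] at this
  have hs : 0 < α - 1 := sub_pos.2 hα
  have e1 : 1 - α = -(α - 1) := by ring
  have e2 : 1 / (1 - α) = -(1 / (α - 1)) := by rw [e1, one_div_neg_eq_neg_one_div]
  rw [e2, e1]
  exact ⟨tendsto_negLogE_trace (fun x => (hC x).nonneg) hPrherm hPrproj hr hs,
    negLogE_antitone (trace_limit_le_Perr (fun x => (hC x).nonneg) hPrherm hPrproj hr hs)⟩

end QHE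
end

section
/- Let (p_1,...,p_r; ρ_1,...,ρ_r) be an ensemble of density operators on a finite-dimensional space with p_x > 0 for all x. If there exist three indices x_1, x_2, x_3 such that ρ_{x_1}, ρ_{x_2}, ρ_{x_3} are three pairwise-distinct pure states, then there exists a positive integer n' such that for all n ≥ n', the error probability of state exclusion on the n-fold ensemble is exactly zero: P_err((p_x)_x, (ρ_x^{⊗n})_x) = 0. -/
open scoped Kronecker
open Matrix Filter Topology
open scoped ComplexOrder
attribute [local instance] Classical.propDecidable

namespace QHE

open scoped MatrixOrder in
lemma exists_conjTranspose_mul_self_of_posSemidef {m : Type*} [Fintype m] [DecidableEq m]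
    {A : Matrix m m ℂ} (hA : A.PosSemidef) : ∃ B : Matrix m m ℂ, A = Bᴴ * B :=
  CStarAlgebra.nonneg_iff_eq_star_mul_self.mp hA.nonneg

lemma trace_mul_re_nonneg {m : Type*} [Fintype m] [DecidableEq m]
    {A B : Matrix m m ℂ} (hA : A.PosSemidef) (hB : B.PosSemidef) :
    0 ≤ ((A * B).trace).re := by
  obtain ⟨C, rfl⟩ := exists_conjTranspose_mul_self_of_posSemidef hA
  rw [Matrix.mul_assoc, Matrix.trace_mul_comm]
  exact (Complex.nonneg_iff.mp (hB.mul_mul_conjTranspose_same C).trace_nonneg).1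

lemma tensPow_mul {n : Type*} [Fintype n] (A B : Matrix n n ℂ) (k : ℕ) :
    tensPow (A * B) k = tensPow A k * tensPow B k := by
  ext f g
  simp only [tensPow, Matrix.of_apply, Matrix.mul_apply, ← Finset.prod_mul_distrib]
  rw [Finset.prod_univ_sum, Fintype.piFinset_univ]

lemma tensPow_conjTranspose {n : Type*} [Fintype n] (A : Matrix n n ℂ) (k : ℕ) :
    tensPow Aᴴ k = (tensPow A k)ᴴ := by
  ext f g
  simp [tensPow]

lemma tensPow_posSemidef {n : Type*} [Fintype n] [DecidableEq n] {A : Matrix n n ℂ}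
    (hA : A.PosSemidef) (k : ℕ) : (tensPow A k).PosSemidef := by
  obtain ⟨B, rfl⟩ := exists_conjTranspose_mul_self_of_posSemidef hA
  rw [tensPow_mul, tensPow_conjTranspose]
  exact Matrix.posSemidef_conjTranspose_mul_self _

/-- The `k`-fold tensor power of a vector. -/
def tensPowVec {n : Type*} (ψ : n → ℂ) (k : ℕ) : (Fin k → n) → ℂ :=
  fun f => ∏ i, ψ (f i)

lemma tensPow_vecMulVec {n : Type*} [Fintype n] (ψ : n → ℂ) (k : ℕ) :
    tensPow (vecMulVec ψ (star ψ)) k =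
      vecMulVec (tensPowVec ψ k) (star (tensPowVec ψ k)) := by
  ext f g
  simp [tensPow, tensPowVec, vecMulVec_apply, Finset.prod_mul_distrib]

lemma star_tensPowVec_dotProduct {n : Type*} [Fintype n] (ψ φ : n → ℂ) (k : ℕ) :
    star (tensPowVec ψ k) ⬝ᵥ tensPowVec φ k = (star ψ ⬝ᵥ φ) ^ k := by
  simp [tensPowVec, dotProduct, Fintype.sum_pow, Finset.prod_mul_distrib]

lemma norm_star_dotProduct_lt_one {n : Type*} [Fintype n] {ψ φ : n → ℂ}
    (hψ : star ψ ⬝ᵥ ψ = 1) (hφ : star φ ⬝ᵥ φ = 1)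
    (hne : vecMulVec ψ (star ψ) ≠ vecMulVec φ (star φ)) : ‖star ψ ⬝ᵥ φ‖ < 1 := by
  set g := star ψ ⬝ᵥ φ with hg
  have hg' : star φ ⬝ᵥ ψ = star g := star_dotProduct φ ψ
  have hdiff : ((vecMulVec ψ (star ψ) - vecMulVec φ (star φ))ᴴ *
      (vecMulVec ψ (star ψ) - vecMulVec φ (star φ))).trace = 2 - 2 * (g * star g) := by
    simp only [conjTranspose_sub, conjTranspose_vecMulVec, star_star, sub_mul, mul_sub,
      vecMulVec_mul_vecMulVec, trace_sub, vecMulVec_smul, trace_smul,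
      trace_vecMulVec, hψ, hφ, hg', ← hg, dotProduct_comm _ (star _), smul_eq_mul]
    ring
  have hpos : (2 - 2 * (g * star g)) ≠ 0 := by
    rw [← hdiff, Ne, trace_conjTranspose_mul_self_eq_zero_iff, sub_eq_zero]
    exact hne
  have hnn : 0 ≤ (2 - 2 * (g * star g)) := by
    rw [← hdiff]
    exact (posSemidef_conjTranspose_mul_self _).trace_nonneg
  have hlt := lt_of_le_of_ne hnn hpos.symm
  rw [Complex.star_def, Complex.mul_conj, Complex.normSq_eq_norm_sq] at hlt
  have : (0 : ℝ) < 2 - 2 * ‖g‖ ^ 2 := by exact_mod_cast hlt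
  nlinarith [norm_nonneg g]

/-- The Hermitian block on two coordinates with diagonal `1 / 2` and off-diagonal entry `g` is
positive semidefinite when `‖g‖ ≤ 1 / 2`. -/
lemma posSemidef_pair_block {m : Type*} [Fintype m] [DecidableEq m] (j k : m) {g : ℂ}
    (hg : ‖g‖ ≤ 1 / 2) :
    (Matrix.single j j (1 / 2) + Matrix.single k k (1 / 2) +
      Matrix.single j k g + Matrix.single k j (star g) : Matrix m m ℂ).PosSemidef := by
  have hdecomp : (Matrix.single j j (1 / 2) + Matrix.single k k (1 / 2) +
      Matrix.single j k g + Matrix.single k j (star g) : Matrix m m ℂ) =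
      (2 : ℝ) • vecMulVec (Pi.single j (1 / 2) + Pi.single k (star g))
        (star (Pi.single j (1 / 2) + Pi.single k (star g))) +
      (1 / 2 - 2 * ‖g‖ ^ 2 : ℝ) • vecMulVec (Pi.single k 1) (star (Pi.single k 1)) := by
    have hgg : star g * g = (‖g‖ : ℂ) ^ 2 := by
      rw [Complex.star_def, mul_comm, Complex.mul_conj, Complex.normSq_eq_norm_sq]
      push_cast; rfl
    have hsingle : ∀ (a b : m) (x y : ℂ),
        vecMulVec (Pi.single a x) (Pi.single b y) = Matrix.single a b (x * y) := fun a b x y => by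
      ext c d
      simp [vecMulVec_apply, Matrix.single_apply, Pi.single_apply, eq_comm (a := c),
        eq_comm (a := d), ite_and]
      split_ifs <;> rfl
    have hkk : (Matrix.single k k (1 / 2) : Matrix m m ℂ) =
        Matrix.single k k ((2 : ℝ) • (star g * g)) +
          Matrix.single k k ((1 / 2 - 2 * ‖g‖ ^ 2 : ℝ) • (1 : ℂ)) := by
      rw [← Matrix.single_add, hgg]
      congr 1
      simp only [Complex.real_smul]
      push_cast
      ring
    have hhalf : ∀ z : ℂ, (2 : ℝ) • (1 / 2 * z) = z ∧ (2 : ℝ) • (z * (1 / 2)) = z := fun z => by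
      simp only [Complex.real_smul]
      push_cast
      constructor <;> ring
    simp only [star_add, ← Pi.single_star, star_star, vecMulVec_add, add_vecMulVec, hsingle,
      smul_add, Matrix.smul_single, hkk, hhalf, star_one, mul_one, star_div₀, star_ofNat]
    abel
  rw [hdecomp]
  refine ((posSemidef_vecMulVec_self_star _).smul (by norm_num)).add
    ((posSemidef_vecMulVec_self_star _).smul ?_)
  nlinarith [norm_nonneg g]

/-- Three unit vectors with pairwise overlaps below `1 / 2` are perfectly antidistinguishable. -/
lemma exists_antidistinguishing_povm {m : Type*} [Fintype m] [DecidableEq m]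
    (v : Fin 3 → m → ℂ) (hv : ∀ i, star (v i) ⬝ᵥ v i = 1)
    (hov : ∀ i j, i ≠ j → ‖star (v i) ⬝ᵥ v j‖ < 1 / 2) :
    ∃ L : Fin 3 → Matrix m m ℂ, (∀ i, (L i).PosSemidef) ∧ ∑ i, L i = 1 ∧
      ∀ i, L i *ᵥ v i = 0 := by
  set V : Matrix m (Fin 3) ℂ := Matrix.of fun a i => v i a with hV
  set G : Matrix (Fin 3) (Fin 3) ℂ := Vᴴ * V with hG
  have hGapp : ∀ i j, G i j = star (v i) ⬝ᵥ v j := fun i j => rfl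
  have hGherm : Gᴴ = G := by simp [hG]
  have hGstar : ∀ i j, star (G i j) = G j i := fun i j => by
    rw [← conjTranspose_apply, hGherm]
  have hdet : IsUnit G.det := by
    refine isUnit_iff_ne_zero.mpr (det_ne_zero_of_sum_row_lt_diag fun i => ?_)
    rw [hGapp i i, hv]
    calc ∑ j ∈ Finset.univ.erase i, ‖G i j‖ < ∑ j ∈ Finset.univ.erase i, (1 / 2 : ℝ) := by
          refine Finset.sum_lt_sum_of_nonempty ⟨i + 1, by fin_cases i <;> simp⟩ fun j hj => ?_
          exact hov i j (Finset.ne_of_mem_erase hj).symm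
      _ = ‖(1 : ℂ)‖ := by simp [Finset.card_erase_of_mem]
  set W := V * G⁻¹ with hW
  have hWH : Wᴴ = G⁻¹ * Vᴴ := by
    rw [hW, conjTranspose_mul, conjTranspose_nonsing_inv, hGherm]
  have hWV : Wᴴ * V = 1 := by
    rw [hWH, Matrix.mul_assoc, ← hG, nonsing_inv_mul _ hdet]
  have hWGW : W * G * Wᴴ = W * Vᴴ := by
    rw [hWH, Matrix.mul_assoc, mul_nonsing_inv_cancel_left _ _ hdet]
  set Q := 1 - W * Vᴴ with hQ
  have hQV : Q * V = 0 := by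
    rw [hQ, Matrix.sub_mul, Matrix.mul_assoc, ← hG, hW, Matrix.mul_assoc,
      nonsing_inv_mul _ hdet]
    simp
  have hQH : Qᴴ = Q := by
    rw [hQ, conjTranspose_sub, conjTranspose_mul, hWH, hW]
    simp [Matrix.mul_assoc]
  have hQpos : Q.PosSemidef := by
    have h : Q * Qᴴ = Q := by
      have : Q * W = 0 := by rw [hW, ← Matrix.mul_assoc, hQV, Matrix.zero_mul]
      rw [hQH]
      nth_rewrite 2 [hQ]
      rw [Matrix.mul_sub, ← Matrix.mul_assoc, this]
      simp
    rw [← h]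
    exact posSemidef_self_mul_conjTranspose Q
  set M : Fin 3 → Matrix (Fin 3) (Fin 3) ℂ := fun i =>
    Matrix.single (i + 1) (i + 1) (1 / 2) + Matrix.single (i + 2) (i + 2) (1 / 2) +
      Matrix.single (i + 1) (i + 2) (G (i + 1) (i + 2)) +
      Matrix.single (i + 2) (i + 1) (star (G (i + 1) (i + 2))) with hM
  have hMpos : ∀ i, (M i).PosSemidef := fun i =>
    posSemidef_pair_block _ _ (hov _ _ (by simp)).le
  have hMsum : ∑ i, M i = G := by
    ext a b
    have h1 : ∀ i, G i i = 1 := fun i => (hGapp i i).trans (hv i)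
    fin_cases a <;> fin_cases b <;>
      simp [hM, Fin.sum_univ_three, h1, hGstar] <;> norm_num
  have hMzero : ∀ i, M i *ᵥ Pi.single i 1 = 0 := fun i => by
    ext a
    fin_cases i <;> fin_cases a <;> simp [hM]
  have hVe : ∀ i, V *ᵥ Pi.single i 1 = v i := fun i => by
    ext a
    simp [hV]
  refine ⟨fun i => W * M i * Wᴴ + if i = 0 then Q else 0, fun i => ?_, ?_, fun i => ?_⟩
  · refine ((hMpos i).mul_mul_conjTranspose_same W).add ?_
    split_ifs
    exacts [hQpos, PosSemidef.zero]
  · rw [Finset.sum_add_distrib, ← Matrix.sum_mul, ← Matrix.mul_sum, hMsum, hWGW]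
    simp [hQ]
  · have hQv : Q *ᵥ v i = 0 := by rw [← hVe, mulVec_mulVec, hQV, zero_mulVec]
    have hWv : Wᴴ *ᵥ v i = Pi.single i 1 := by
      rw [← hVe, mulVec_mulVec, hWV, one_mulVec]
    rw [add_mulVec, ← mulVec_mulVec, hWv, ← mulVec_mulVec, hMzero, mulVec_zero, zero_add]
    split_ifs
    exacts [hQv, zero_mulVec _]

lemma Perr_eq_zero_of_povm {m ι : Type*} [Fintype m] [DecidableEq m] [Fintype ι]
    {p : ι → ℝ} {ρ : ι → Matrix m m ℂ} (hp : ∀ x, 0 ≤ p x) (hρ : ∀ x, (ρ x).PosSemidef)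
    {κ : Type*} [Fintype κ] (e : κ ↪ ι) (L : κ → Matrix m m ℂ)
    (hL : ∀ i, (L i).PosSemidef) (hsum : ∑ i, L i = 1) (hzero : ∀ i, L i * ρ (e i) = 0) :
    Perr p ρ = 0 := by
  refine IsLeast.csInf_eq ⟨⟨Function.extend e L 0, fun x => ?_, ?_, ?_⟩, ?_⟩
  · by_cases hx : ∃ i, e i = x
    · obtain ⟨i, rfl⟩ := hx
      rw [e.injective.extend_apply]
      exact hL i
    · rw [Function.extend_apply' _ _ _ hx]
      exact PosSemidef.zero
  · rw [← hsum]
    refine (Fintype.sum_of_injective e e.injective _ _ (fun x hx => ?_) fun i => ?_).symm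
    · exact Function.extend_apply' _ _ _ (by simpa using hx)
    · rw [e.injective.extend_apply]
  · refine (Finset.sum_eq_zero fun x _ => ?_).symm
    by_cases hx : ∃ i, e i = x
    · obtain ⟨i, rfl⟩ := hx
      simp [e.injective.extend_apply, hzero]
    · simp [Function.extend_apply' _ _ _ hx]
  · rintro _ ⟨Λ, hΛ, -, rfl⟩
    exact Finset.sum_nonneg fun x _ => mul_nonneg (hp x) (trace_mul_re_nonneg (hΛ x) (hρ x))


/-- if an ensemble contains three pairwise-distinct pure states,
then the n-fold error probability of state exclusion is exactly zero for all
sufficiently large n. -/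
theorem three_pure_states_perfect_exclusion
    {n ι : Type} [Fintype n] [DecidableEq n] [Fintype ι] [Nonempty ι]
    (p : ι → ℝ) (ρ : ι → Matrix n n ℂ)
    (hp : ∀ x, 0 < p x) (hp1 : ∑ x, p x = 1) (hρ : ∀ x, IsState (ρ x))
    (x₁ x₂ x₃ : ι) (h12 : x₁ ≠ x₂) (h23 : x₂ ≠ x₃) (h13 : x₁ ≠ x₃)
    (hpure : ∀ x ∈ ({x₁, x₂, x₃} : Set ι),
      ∃ ψ : n → ℂ, ρ x = Matrix.vecMulVec ψ (star ψ))
    (hd12 : ρ x₁ ≠ ρ x₂) (hd23 : ρ x₂ ≠ ρ x₃) (hd13 : ρ x₁ ≠ ρ x₃) :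
    ∃ n' : ℕ, 0 < n' ∧ ∀ k : ℕ, n' ≤ k → Perr p (fun x => tensPow (ρ x) k) = 0 := by
  have hstate : ∀ {x ψ}, ρ x = vecMulVec ψ (star ψ) → star ψ ⬝ᵥ ψ = 1 := fun {x ψ} h => by
    rw [dotProduct_comm, ← trace_vecMulVec, ← h]
    exact (hρ x).2
  let e : Fin 3 ↪ ι := ⟨![x₁, x₂, x₃], by
    intro i j
    fin_cases i <;> fin_cases j <;> simp [h12, h23, h13, h12.symm, h23.symm, h13.symm]⟩
  have he : ∀ i, e i ∈ ({x₁, x₂, x₃} : Set ι) := fun i => by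
    change ![x₁, x₂, x₃] i ∈ _
    fin_cases i <;> simp
  have hed : ∀ i j, i ≠ j → ρ (e i) ≠ ρ (e j) := fun i j => by
    change i ≠ j → ρ (![x₁, x₂, x₃] i) ≠ ρ (![x₁, x₂, x₃] j)
    fin_cases i <;> fin_cases j <;>
      simp [hd12, hd23, hd13, hd12.symm, hd23.symm, hd13.symm]
  choose ψ hψ using fun i => hpure (e i) (he i)
  have hunit : ∀ i, star (ψ i) ⬝ᵥ ψ i = 1 := fun i => hstate (hψ i)
  have hsmall : ∀ᶠ k : ℕ in atTop, ∀ i j, i ≠ j → ‖(star (ψ i) ⬝ᵥ ψ j) ^ k‖ < 1 / 2 := by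
    simp only [eventually_all, norm_pow]
    intro i j hij
    have hlt := norm_star_dotProduct_lt_one (hunit i) (hunit j)
      (by rw [← hψ, ← hψ]; exact hed i j hij)
    exact (tendsto_pow_atTop_nhds_zero_of_lt_one (norm_nonneg _) hlt).eventually_lt_const
      (by norm_num)
  obtain ⟨N, hN⟩ := eventually_atTop.mp hsmall
  refine ⟨N + 1, N.succ_pos, fun k hk => ?_⟩
  obtain ⟨L, hL, hsum, hzero⟩ := exists_antidistinguishing_povm
    (fun i => tensPowVec (ψ i) k)
    (fun i => by rw [star_tensPowVec_dotProduct, hunit, one_pow])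
    (fun i j hij => by
      rw [star_tensPowVec_dotProduct]
      exact hN k (N.le_succ.trans hk) i j hij)
  refine Perr_eq_zero_of_povm (fun x => (hp x).le) (fun x => tensPow_posSemidef (hρ x).1 k)
    e L hL hsum fun i => ?_
  rw [hψ, tensPow_vecMulVec, mul_vecMulVec, hzero, zero_vecMulVec]

end QHE
end
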